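/- Fix reals α > 0 and γ > 0, and define for λ > 0 the integral F(λ) = ∫_{[0,1]²} π² α sin²(2π k_1) / [ ( sin²(π k_1) + sin²(π k_2) ) · ( λ + 8γ ( sin²(π k_1) + sin²(π k_2) ) ) ] dk_1 dk_2 (the integrand being set to 0 where sin²(π k_1) + sin²(π k_2) = 0). Then there exist constants 0 < c ≤ C and λ₀ ∈ (0,1) such that for every λ ∈ (0, λ₀], c log(1/λ) ≤ F(λ) ≤ C log(1/λ). -/

import Mathlib

open Real MeasureTheory

/-- The integrand of `F`, as a function of two real variables; at the zeros of
`sin²(πx) + sin²(πy)` it vanishes since division by zero gives zero. -/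
noncomputable def greenKuboIntegrand (α gam lam x y : ℝ) : ℝ :=
  π ^ 2 * α * Real.sin (2 * π * x) ^ 2 /
    ((Real.sin (π * x) ^ 2 + Real.sin (π * y) ^ 2) *
      (lam + 8 * gam * (Real.sin (π * x) ^ 2 + Real.sin (π * y) ^ 2)))

lemma two_mul_le_sin_pi_mul {x : ℝ} (h0 : 0 ≤ x) (h1 : x ≤ 1 / 2) :
    2 * x ≤ Real.sin (π * x) := by
  have h := Real.mul_le_sin (x := π * x) (by positivity) (by nlinarith [Real.pi_pos])
  have e : 2 / π * (π * x) = 2 * x := by field_simp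
  rwa [e] at h

lemma integral_comp_sin_pi_mul_le {h : ℝ → ℝ} (hc : Continuous h)
    (ha : AntitoneOn h (Set.Ici 0)) (hn : ∀ x, 0 ≤ h x) :
    ∫ x in (0 : ℝ)..1, h (Real.sin (π * x)) ≤ 2 * ∫ x in (0 : ℝ)..1, h (2 * x) := by
  have hrefl : ∫ x in (0 : ℝ)..1, h (2 * (1 - x)) = ∫ x in (0 : ℝ)..1, h (2 * x) := by
    simpa using intervalIntegral.integral_comp_sub_left (a := 0) (b := 1)
      (fun x => h (2 * x)) 1
  have hi1 : IntervalIntegrable (fun x => h (2 * x)) volume 0 1 :=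
    (by fun_prop : Continuous fun x => h (2 * x)).intervalIntegrable _ _
  have hi2 : IntervalIntegrable (fun x => h (2 * (1 - x))) volume 0 1 :=
    (by fun_prop : Continuous fun x => h (2 * (1 - x))).intervalIntegrable _ _
  have hi3 : IntervalIntegrable (fun x => h (Real.sin (π * x))) volume 0 1 :=
    (by fun_prop : Continuous fun x => h (Real.sin (π * x))).intervalIntegrable _ _
  calc ∫ x in (0 : ℝ)..1, h (Real.sin (π * x))
      ≤ ∫ x in (0 : ℝ)..1, (h (2 * x) + h (2 * (1 - x))) := by
        refine intervalIntegral.integral_mono_on zero_le_one hi3 (hi1.add hi2) ?_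
        rintro x ⟨h0, h1⟩
        rcases le_total x (1 / 2) with hx | hx
        · have hs := two_mul_le_sin_pi_mul h0 hx
          have := ha (Set.mem_Ici.2 (by positivity)) (Set.mem_Ici.2 (by linarith)) hs
          linarith [hn (2 * (1 - x))]
        · have hs := two_mul_le_sin_pi_mul (x := 1 - x) (by linarith) (by linarith)
          have e : Real.sin (π * (1 - x)) = Real.sin (π * x) := by
            rw [mul_sub, mul_one, Real.sin_pi_sub]
          rw [e] at hs
          have := ha (Set.mem_Ici.2 (by linarith)) (Set.mem_Ici.2 (by linarith)) hs
          linarith [hn (2 * x)]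
    _ = 2 * ∫ x in (0 : ℝ)..1, h (2 * x) := by
        rw [intervalIntegral.integral_add hi1 hi2, hrefl]; ring

lemma integral_inv_add_sq_le {p q : ℝ} (hp : 0 < p) (hq : 0 < q) :
    ∫ x in (0 : ℝ)..1, (p ^ 2 + (q * x) ^ 2)⁻¹ ≤ 2 / (q * p) := by
  have hpos : ∀ x ∈ Set.Icc (0 : ℝ) 1, 0 < p + q * x := fun x hx => by
    have := mul_nonneg hq.le hx.1; linarith
  have hcont : ContinuousOn (fun x => 2 / (p + q * x) ^ 2) (Set.Icc 0 1) :=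
    continuousOn_const.div (by fun_prop) fun x hx => (pow_pos (hpos x hx) 2).ne'
  have hint : IntervalIntegrable (fun x => 2 / (p + q * x) ^ 2) volume 0 1 :=
    ContinuousOn.intervalIntegrable_of_Icc zero_le_one hcont
  have hftc : ∫ x in (0 : ℝ)..1, 2 / (p + q * x) ^ 2 =
      -2 / (q * (p + q * 1)) - -2 / (q * (p + q * 0)) := by
    refine intervalIntegral.integral_eq_sub_of_hasDerivAt
      (f := fun x => -2 / (q * (p + q * x))) (fun x hx => ?_) hint
    rw [Set.uIcc_of_le zero_le_one] at hx
    have hx' := hpos x hx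
    have h1 : HasDerivAt (fun x => q * (p + q * x)) (q * q) x := by
      simpa using (((hasDerivAt_id x).const_mul q).const_add p).const_mul q
    refine ((hasDerivAt_const x (-2 : ℝ)).div h1 (by positivity)).congr_deriv ?_
    field_simp
    ring
  have hmono : ∫ x in (0 : ℝ)..1, (p ^ 2 + (q * x) ^ 2)⁻¹ ≤
      ∫ x in (0 : ℝ)..1, 2 / (p + q * x) ^ 2 := by
    refine intervalIntegral.integral_mono_on zero_le_one
      (Continuous.intervalIntegrable ?_ _ _) hint fun x hx => ?_
    · exact Continuous.inv₀ (by fun_prop) fun x => by positivity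
    · have hx' := hpos x hx
      rw [inv_eq_one_div, div_le_div_iff₀ (by positivity) (by positivity)]
      nlinarith [sq_nonneg (p - q * x)]
  have h3 : 0 ≤ 2 / (q * (p + q * 1)) := by positivity
  have e : -2 / (q * (p + q * 1)) - -2 / (q * (p + q * 0)) =
      2 / (q * p) - 2 / (q * (p + q * 1)) := by
    rw [mul_zero, add_zero]; ring
  linarith

lemma integral_inv_sqrt_add_sq_le {p q : ℝ} (hp : 0 < p) (hq : 0 < q) :
    ∫ x in (0 : ℝ)..1, (√(p ^ 2 + (q * x) ^ 2))⁻¹ ≤ 2 / q * Real.log (1 + q / p) := by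
  have hpos : ∀ x ∈ Set.Icc (0 : ℝ) 1, 0 < p + q * x := fun x hx => by
    have := mul_nonneg hq.le hx.1; linarith
  have hcont : ContinuousOn (fun x => 2 / (p + q * x)) (Set.Icc 0 1) :=
    continuousOn_const.div (by fun_prop) fun x hx => (hpos x hx).ne'
  have hint : IntervalIntegrable (fun x => 2 / (p + q * x)) volume 0 1 :=
    ContinuousOn.intervalIntegrable_of_Icc zero_le_one hcont
  have hftc : ∫ x in (0 : ℝ)..1, 2 / (p + q * x) =
      2 / q * Real.log (p + q * 1) - 2 / q * Real.log (p + q * 0) := by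
    refine intervalIntegral.integral_eq_sub_of_hasDerivAt
      (f := fun x => 2 / q * Real.log (p + q * x)) (fun x hx => ?_) hint
    rw [Set.uIcc_of_le zero_le_one] at hx
    have hx' := hpos x hx
    have h1 : HasDerivAt (fun x => p + q * x) q x := by
      simpa using ((hasDerivAt_id x).const_mul q).const_add p
    refine ((h1.log hx'.ne').const_mul (2 / q)).congr_deriv ?_
    field_simp
  have hmono : ∫ x in (0 : ℝ)..1, (√(p ^ 2 + (q * x) ^ 2))⁻¹ ≤
      ∫ x in (0 : ℝ)..1, 2 / (p + q * x) := by
    refine intervalIntegral.integral_mono_on zero_le_one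
      (Continuous.intervalIntegrable ?_ _ _) hint fun x hx => ?_
    · exact Continuous.inv₀ (by fun_prop) fun x => by positivity
    · have hx' := hpos x hx
      have hs : (p + q * x) / 2 ≤ √(p ^ 2 + (q * x) ^ 2) := by
        apply Real.le_sqrt_of_sq_le
        nlinarith [sq_nonneg (p - q * x), sq_nonneg (p + q * x)]
      rw [inv_eq_one_div, div_le_div_iff₀ (by positivity) hx']
      linarith
  have e : 1 + q / p = (p + q * 1) / (p + q * 0) := by field_simp; ring
  rw [e, Real.log_div (by positivity) (by simpa using hp.ne')]
  linarith

lemma integral_inv_add_mul_sin_sq_le {a b : ℝ} (ha : 0 < a) (hb : 0 < b) :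
    ∫ y in (0 : ℝ)..1, (a + b * Real.sin (π * y) ^ 2)⁻¹ ≤ 2 / √b * (√a)⁻¹ := by
  have h := integral_comp_sin_pi_mul_le (h := fun s => (a + b * s ^ 2)⁻¹)
    (Continuous.inv₀ (by fun_prop) fun x => by positivity)
    (fun s hs t _ hst => by
      have hs' : 0 ≤ s := hs
      dsimp only
      gcongr)
    (fun s => by positivity)
  have h2 := integral_inv_add_sq_le (p := √a) (q := 2 * √b) (by positivity) (by positivity)
  have e : ∀ x : ℝ, √a ^ 2 + (2 * √b * x) ^ 2 = a + b * (2 * x) ^ 2 := fun x => by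
    rw [mul_pow, mul_pow, Real.sq_sqrt ha.le, Real.sq_sqrt hb.le]; ring
  simp only [e] at h2
  have e2 : 2 * (2 / (2 * √b * √a)) = 2 / √b * (√a)⁻¹ := by
    field_simp
  linarith

lemma integral_inv_sqrt_add_mul_sin_sq_le {a b : ℝ} (ha : 0 < a) (hb : 0 < b) :
    ∫ x in (0 : ℝ)..1, (√(a + b * Real.sin (π * x) ^ 2))⁻¹ ≤
      2 / √b * Real.log (1 + 2 * √b / √a) := by
  have h := integral_comp_sin_pi_mul_le (h := fun s => (√(a + b * s ^ 2))⁻¹)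
    (Continuous.inv₀ (by fun_prop) fun x => by positivity)
    (fun s hs t _ hst => by
      have hs' : 0 ≤ s := hs
      dsimp only
      gcongr)
    (fun s => by positivity)
  have h2 := integral_inv_sqrt_add_sq_le (p := √a) (q := 2 * √b) (by positivity)
    (by positivity)
  have e : ∀ x : ℝ, √a ^ 2 + (2 * √b * x) ^ 2 = a + b * (2 * x) ^ 2 := fun x => by
    rw [mul_pow, mul_pow, Real.sq_sqrt ha.le, Real.sq_sqrt hb.le]; ring
  simp only [e] at h2
  have e2 : 2 * (2 / (2 * √b) * Real.log (1 + 2 * √b / √a)) =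
      2 / √b * Real.log (1 + 2 * √b / √a) := by
    field_simp
  linarith

section Integrand

variable {α gam lam : ℝ}

lemma greenKuboIntegrand_nonneg (hα : 0 < α) (hgam : 0 < gam) (hlam : 0 < lam) (x y : ℝ) :
    0 ≤ greenKuboIntegrand α gam lam x y := by
  unfold greenKuboIntegrand; positivity

lemma sin_two_pi_mul_sq (x : ℝ) : Real.sin (2 * π * x) ^ 2 =
    4 * Real.sin (π * x) ^ 2 * (1 - Real.sin (π * x) ^ 2) := by
  rw [mul_assoc, Real.sin_two_mul, ← Real.cos_sq']; ring

lemma greenKuboIntegrand_le (hα : 0 < α) (hgam : 0 < gam) (hlam : 0 < lam) (x y : ℝ) :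
    greenKuboIntegrand α gam lam x y ≤ 4 * π ^ 2 * α *
      (lam + 8 * gam * Real.sin (π * x) ^ 2 + 8 * gam * Real.sin (π * y) ^ 2)⁻¹ := by
  unfold greenKuboIntegrand
  rw [sin_two_pi_mul_sq]
  set s := Real.sin (π * x) ^ 2
  set t := Real.sin (π * y) ^ 2
  have hs : 0 ≤ s := sq_nonneg _
  have ht : 0 ≤ t := sq_nonneg _
  have e : lam + 8 * gam * (s + t) = lam + 8 * gam * s + 8 * gam * t := by ring
  rw [e, ← div_div, ← div_eq_mul_inv]
  gcongr
  refine div_le_of_le_mul₀ (by positivity) (by positivity) ?_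
  have : s * (1 - s) ≤ s + t := by nlinarith
  calc π ^ 2 * α * (4 * s * (1 - s)) = 4 * π ^ 2 * α * (s * (1 - s)) := by ring
    _ ≤ 4 * π ^ 2 * α * (s + t) := by gcongr

lemma le_greenKuboIntegrand (hα : 0 < α) (hgam : 0 < gam) (hlam : 0 < lam) {x y : ℝ}
    (hx0 : 0 ≤ x) (hx : x ≤ 1 / 4) (hy0 : 0 ≤ y) (hyx : y ≤ x) (hx' : 0 < x) :
    4 * α / (lam + 16 * gam * π ^ 2 * x ^ 2) ≤ greenKuboIntegrand α gam lam x y := by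
  have hpi := Real.pi_pos
  have hsx : 2 * x ≤ Real.sin (π * x) := two_mul_le_sin_pi_mul hx0 (by linarith)
  have hsy : 2 * y ≤ Real.sin (π * y) := two_mul_le_sin_pi_mul hy0 (by linarith)
  have hsx2 : Real.sin (π * x) ≤ π * x := Real.sin_le (by positivity)
  have hsy2 : Real.sin (π * y) ≤ π * x :=
    (Real.sin_le (by positivity)).trans (by gcongr)
  have hhalf : Real.sin (π * x) ^ 2 ≤ 1 / 2 := by
    have h1 : Real.sin (π * x) ≤ Real.sin (π / 4) :=
      Real.sin_le_sin_of_le_of_le_pi_div_two (by nlinarith) (by linarith) (by nlinarith)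
    rw [Real.sin_pi_div_four] at h1
    have h2 : Real.sin (π * x) ^ 2 ≤ (√2 / 2) ^ 2 := by
      gcongr
      linarith
    rw [div_pow, Real.sq_sqrt (by norm_num)] at h2
    linarith
  have h1 : (2 * x) ^ 2 ≤ Real.sin (π * x) ^ 2 := by gcongr
  have h2 : Real.sin (π * x) ^ 2 ≤ (π * x) ^ 2 := by
    gcongr
    linarith
  have h3 : Real.sin (π * y) ^ 2 ≤ (π * x) ^ 2 := by
    gcongr
    linarith
  unfold greenKuboIntegrand
  rw [sin_two_pi_mul_sq]
  set s := Real.sin (π * x) ^ 2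
  set t := Real.sin (π * y) ^ 2
  have ht : 0 ≤ t := sq_nonneg _
  have hs : 0 < s := lt_of_lt_of_le (by positivity) h1
  have hst : s + t ≤ 2 * π ^ 2 * x ^ 2 := by nlinarith
  have hnum : 8 * x ^ 2 ≤ 4 * s * (1 - s) := by nlinarith
  calc 4 * α / (lam + 16 * gam * π ^ 2 * x ^ 2)
      = π ^ 2 * α * (8 * x ^ 2) / ((2 * π ^ 2 * x ^ 2) *
          (lam + 8 * gam * (2 * π ^ 2 * x ^ 2))) := by
        have : lam + 16 * gam * π ^ 2 * x ^ 2 ≠ 0 := by positivity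
        have e : lam + 8 * gam * (2 * π ^ 2 * x ^ 2) = lam + 16 * gam * π ^ 2 * x ^ 2 := by
          ring
        rw [e]
        field_simp
        norm_num
    _ ≤ _ := by
        have : 0 ≤ 4 * s * (1 - s) := le_trans (by positivity) hnum
        gcongr

lemma measurable_greenKuboIntegrand :
    Measurable (fun z : ℝ × ℝ => greenKuboIntegrand α gam lam z.1 z.2) := by
  unfold greenKuboIntegrand; fun_prop

lemma norm_greenKuboIntegrand_le (hα : 0 < α) (hgam : 0 < gam) (hlam : 0 < lam) (x y : ℝ) :
    ‖greenKuboIntegrand α gam lam x y‖ ≤ 4 * π ^ 2 * α * lam⁻¹ := by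
  rw [Real.norm_of_nonneg (greenKuboIntegrand_nonneg hα hgam hlam x y)]
  refine (greenKuboIntegrand_le hα hgam hlam x y).trans ?_
  gcongr
  have := mul_nonneg hgam.le (sq_nonneg (Real.sin (π * x)))
  have := mul_nonneg hgam.le (sq_nonneg (Real.sin (π * y)))
  linarith

lemma integrable_greenKuboIntegrand (hα : 0 < α) (hgam : 0 < gam) (hlam : 0 < lam) :
    Integrable (fun z : ℝ × ℝ => greenKuboIntegrand α gam lam z.1 z.2)
      ((volume.restrict (Set.Icc 0 1)).prod (volume.restrict (Set.Icc 0 1))) :=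
  Integrable.of_bound measurable_greenKuboIntegrand.aestronglyMeasurable
    (4 * π ^ 2 * α * lam⁻¹)
    (Filter.Eventually.of_forall fun z => norm_greenKuboIntegrand_le hα hgam hlam z.1 z.2)

lemma integrableOn_greenKuboIntegrand_right (hα : 0 < α) (hgam : 0 < gam) (hlam : 0 < lam)
    (x : ℝ) : IntegrableOn (greenKuboIntegrand α gam lam x) (Set.Icc 0 1) :=
  Integrable.of_bound
    (measurable_greenKuboIntegrand.comp measurable_prodMk_left).aestronglyMeasurable
    (4 * π ^ 2 * α * lam⁻¹)
    (Filter.Eventually.of_forall fun y => norm_greenKuboIntegrand_le hα hgam hlam x y)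

lemma setIntegral_Icc_fin_two {f : ℝ → ℝ → ℝ}
    (hf : Integrable (fun z : ℝ × ℝ => f z.1 z.2)
      ((volume.restrict (Set.Icc 0 1)).prod (volume.restrict (Set.Icc 0 1)))) :
    ∫ k in Set.Icc (0 : Fin 2 → ℝ) 1, f (k 0) (k 1) =
      ∫ x in Set.Icc (0 : ℝ) 1, ∫ y in Set.Icc (0 : ℝ) 1, f x y := by
  have hpre : Set.Icc (0 : Fin 2 → ℝ) 1 =
      MeasurableEquiv.finTwoArrow ⁻¹' (Set.Icc (0 : ℝ) 1 ×ˢ Set.Icc (0 : ℝ) 1) := by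
    ext k
    simp [Pi.le_def, Fin.forall_fin_two, MeasurableEquiv.finTwoArrow]
  have h := (volume_preserving_finTwoArrow ℝ).setIntegral_preimage_emb
    MeasurableEquiv.finTwoArrow.measurableEmbedding (fun z : ℝ × ℝ => f z.1 z.2)
    (Set.Icc (0 : ℝ) 1 ×ˢ Set.Icc (0 : ℝ) 1)
  rw [← hpre] at h
  refine Eq.trans h ?_
  rw [Measure.volume_eq_prod, ← Measure.prod_restrict]
  exact integral_prod _ hf

lemma integral_greenKuboIntegrand_le (hα : 0 < α) (hgam : 0 < gam) (hlam : 0 < lam) :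
    ∫ x in Set.Icc (0 : ℝ) 1, ∫ y in Set.Icc (0 : ℝ) 1, greenKuboIntegrand α gam lam x y ≤
      2 * π ^ 2 * α / gam * Real.log (1 + 2 * √(8 * gam) / √lam) := by
  have hb : 0 < 8 * gam := by positivity
  have hinner : ∀ x : ℝ, ∫ y in Set.Icc (0 : ℝ) 1, greenKuboIntegrand α gam lam x y ≤
      4 * π ^ 2 * α * (2 / √(8 * gam)) *
        (√(lam + 8 * gam * Real.sin (π * x) ^ 2))⁻¹ := fun x => by
    have ha : 0 < lam + 8 * gam * Real.sin (π * x) ^ 2 := by positivity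
    have hc : Continuous fun y => 4 * π ^ 2 * α *
        (lam + 8 * gam * Real.sin (π * x) ^ 2 + 8 * gam * Real.sin (π * y) ^ 2)⁻¹ :=
      continuous_const.mul (Continuous.inv₀ (by fun_prop) fun y => by positivity)
    have h1 := setIntegral_mono (integrableOn_greenKuboIntegrand_right hα hgam hlam x)
      (hc.integrableOn_Icc (a := 0) (b := 1)) (greenKuboIntegrand_le hα hgam hlam x)
    rw [integral_const_mul, integral_Icc_eq_integral_Ioc (y := (1 : ℝ)) (f := fun y =>
      (lam + 8 * gam * Real.sin (π * x) ^ 2 + 8 * gam * Real.sin (π * y) ^ 2)⁻¹),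
      ← intervalIntegral.integral_of_le zero_le_one] at h1
    refine h1.trans ?_
    rw [mul_assoc (4 * π ^ 2 * α)]
    gcongr
    exact integral_inv_add_mul_sin_sq_le ha hb
  have hc : Continuous fun x => 4 * π ^ 2 * α * (2 / √(8 * gam)) *
      (√(lam + 8 * gam * Real.sin (π * x) ^ 2))⁻¹ :=
    continuous_const.mul (Continuous.inv₀ (by fun_prop) fun y => by positivity)
  have h1 := setIntegral_mono (integrable_greenKuboIntegrand hα hgam hlam).integral_prod_left
    (hc.integrableOn_Icc (a := 0) (b := 1)) hinner
  rw [integral_const_mul, integral_Icc_eq_integral_Ioc (y := (1 : ℝ)) (f := fun x =>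
      (√(lam + 8 * gam * Real.sin (π * x) ^ 2))⁻¹),
      ← intervalIntegral.integral_of_le zero_le_one] at h1
  have h2 := integral_inv_sqrt_add_mul_sin_sq_le hlam hb
  calc _ ≤ _ := h1
    _ ≤ 4 * π ^ 2 * α * (2 / √(8 * gam)) *
        (2 / √(8 * gam) * Real.log (1 + 2 * √(8 * gam) / √lam)) := by gcongr
    _ = 4 * π ^ 2 * α * (4 / √(8 * gam) ^ 2) *
        Real.log (1 + 2 * √(8 * gam) / √lam) := by ring
    _ = _ := by
        rw [Real.sq_sqrt hb.le]
        congr 1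
        field_simp
        norm_num

lemma le_integral_greenKuboIntegrand (hα : 0 < α) (hgam : 0 < gam) (hlam : 0 < lam) :
    α / (8 * gam * π ^ 2) * Real.log (1 + gam * π ^ 2 / lam) ≤
      ∫ x in Set.Icc (0 : ℝ) 1, ∫ y in Set.Icc (0 : ℝ) 1,
        greenKuboIntegrand α gam lam x y := by
  have hpi := Real.pi_pos
  have hsub : Set.Icc (0 : ℝ) (1 / 4) ⊆ Set.Icc 0 1 :=
    Set.Icc_subset_Icc_right (by norm_num)
  have hinner : ∀ x ∈ Set.Icc (0 : ℝ) (1 / 4),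
      4 * α / (lam + 16 * gam * π ^ 2 * x ^ 2) * x ≤
        ∫ y in Set.Icc (0 : ℝ) 1, greenKuboIntegrand α gam lam x y := by
    rintro x ⟨hx0, hx⟩
    rcases hx0.eq_or_lt with rfl | hx'
    · rw [mul_zero]
      exact integral_nonneg fun y => greenKuboIntegrand_nonneg hα hgam hlam 0 y
    have hyx : Set.Icc 0 x ⊆ Set.Icc (0 : ℝ) 1 := Set.Icc_subset_Icc_right (by linarith)
    calc 4 * α / (lam + 16 * gam * π ^ 2 * x ^ 2) * x
        = ∫ _ in Set.Icc 0 x, 4 * α / (lam + 16 * gam * π ^ 2 * x ^ 2) := by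
          simp [hx0, mul_comm]
      _ ≤ ∫ y in Set.Icc 0 x, greenKuboIntegrand α gam lam x y := by
          refine setIntegral_mono_on (by simp)
            ((integrableOn_greenKuboIntegrand_right hα hgam hlam x).mono_set hyx)
            measurableSet_Icc fun y hy => ?_
          exact le_greenKuboIntegrand hα hgam hlam hx0 hx hy.1 hy.2 hx'
      _ ≤ _ := setIntegral_mono_set (integrableOn_greenKuboIntegrand_right hα hgam hlam x)
          (Filter.Eventually.of_forall fun y => greenKuboIntegrand_nonneg hα hgam hlam x y)
          hyx.eventuallyLE
  have hc : Continuous fun x : ℝ => 4 * α / (lam + 16 * gam * π ^ 2 * x ^ 2) * x :=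
    (continuous_const.div (by fun_prop) fun x => by positivity).mul continuous_id
  have hftc : ∫ x in (0 : ℝ)..(1 / 4), 4 * α / (lam + 16 * gam * π ^ 2 * x ^ 2) * x =
      α / (8 * gam * π ^ 2) * Real.log (lam + 16 * gam * π ^ 2 * (1 / 4) ^ 2) -
        α / (8 * gam * π ^ 2) * Real.log (lam + 16 * gam * π ^ 2 * 0 ^ 2) := by
    refine intervalIntegral.integral_eq_sub_of_hasDerivAt
      (f := fun x => α / (8 * gam * π ^ 2) * Real.log (lam + 16 * gam * π ^ 2 * x ^ 2))
      (fun x _ => ?_) (hc.intervalIntegrable _ _)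
    have h0 : lam + 16 * gam * π ^ 2 * x ^ 2 ≠ 0 := by positivity
    have h1 : HasDerivAt (fun x => lam + 16 * gam * π ^ 2 * x ^ 2)
        (16 * gam * π ^ 2 * (2 * x)) x := by
      simpa using ((hasDerivAt_pow 2 x).const_mul (16 * gam * π ^ 2)).const_add lam
    refine ((h1.log h0).const_mul (α / (8 * gam * π ^ 2))).congr_deriv ?_
    field_simp
    ring
  have hint := (integrable_greenKuboIntegrand hα hgam hlam).integral_prod_left
  calc α / (8 * gam * π ^ 2) * Real.log (1 + gam * π ^ 2 / lam)
      = ∫ x in (0 : ℝ)..(1 / 4), 4 * α / (lam + 16 * gam * π ^ 2 * x ^ 2) * x := by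
        have e : 1 + gam * π ^ 2 / lam = (lam + 16 * gam * π ^ 2 * (1 / 4) ^ 2) /
            (lam + 16 * gam * π ^ 2 * 0 ^ 2) := by
          field_simp
          ring
        rw [hftc, e, Real.log_div (by positivity) (by positivity)]
        ring
    _ = ∫ x in Set.Icc (0 : ℝ) (1 / 4), 4 * α / (lam + 16 * gam * π ^ 2 * x ^ 2) * x := by
        rw [integral_Icc_eq_integral_Ioc,
          intervalIntegral.integral_of_le (by norm_num)]
    _ ≤ ∫ x in Set.Icc (0 : ℝ) (1 / 4), ∫ y in Set.Icc (0 : ℝ) 1,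
          greenKuboIntegrand α gam lam x y :=
        setIntegral_mono_on hc.integrableOn_Icc
          (IntegrableOn.mono_set (t := Set.Icc 0 1) hint hsub) measurableSet_Icc hinner
    _ ≤ _ := setIntegral_mono_set hint
        (Filter.Eventually.of_forall fun x =>
          integral_nonneg fun y => greenKuboIntegrand_nonneg hα hgam hlam x y)
        hsub.eventuallyLE

end Integrand

/-- Fix reals `α > 0` and `γ > 0`, and define for `λ > 0` the integral
`F(λ) = ∫_{[0,1]²} π² α sin²(2π k_1) / [ (sin²(π k_1) + sin²(π k_2)) ·
(λ + 8γ (sin²(π k_1) + sin²(π k_2))) ] dk` (the integrand being set to `0` where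
`sin²(π k_1) + sin²(π k_2) = 0`). Then there exist constants `0 < c ≤ C` and `λ₀ ∈ (0,1)`
such that for every `λ ∈ (0, λ₀]`, `c log(1/λ) ≤ F(λ) ≤ C log(1/λ)`. -/
theorem stmt17 (α gam : ℝ) (hα : 0 < α) (hgam : 0 < gam)
    (F : ℝ → ℝ)
    (hF : ∀ lam : ℝ, 0 < lam → F lam =
      ∫ k in Set.Icc (0 : Fin 2 → ℝ) 1,
        if Real.sin (π * k 0) ^ 2 + Real.sin (π * k 1) ^ 2 ≠ 0 then
          π ^ 2 * α * Real.sin (2 * π * k 0) ^ 2 /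
            ((Real.sin (π * k 0) ^ 2 + Real.sin (π * k 1) ^ 2) *
              (lam + 8 * gam * (Real.sin (π * k 0) ^ 2 + Real.sin (π * k 1) ^ 2)))
        else 0) :
    ∃ c C lam₀ : ℝ, 0 < c ∧ c ≤ C ∧ lam₀ ∈ Set.Ioo (0 : ℝ) 1 ∧
      ∀ lam ∈ Set.Ioc (0 : ℝ) lam₀,
        c * Real.log (1 / lam) ≤ F lam ∧ F lam ≤ C * Real.log (1 / lam) := by
  have hpi := Real.pi_pos
  have hFeq : ∀ lam : ℝ, 0 < lam → F lam = ∫ x in Set.Icc (0 : ℝ) 1,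
      ∫ y in Set.Icc (0 : ℝ) 1, greenKuboIntegrand α gam lam x y := fun lam hlam => by
    rw [hF lam hlam, ← setIntegral_Icc_fin_two (integrable_greenKuboIntegrand hα hgam hlam)]
    congr 1 with k
    unfold greenKuboIntegrand
    split_ifs with h
    · rfl
    · rw [not_not.1 h]; simp
  set q := 2 * √(8 * gam) with hq
  have hq0 : 0 < q := by positivity
  refine ⟨α / (16 * gam * π ^ 2), 2 * π ^ 2 * α / gam,
    min (1 / 2) (min ((1 / (1 + q)) ^ 2) ((gam * π ^ 2) ^ 2)), by positivity, ?_,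
    ⟨by positivity, (min_le_left _ _).trans_lt (by norm_num)⟩, ?_⟩
  · have h3 := Real.pi_gt_three
    have hp2 : 1 ≤ π ^ 2 := by nlinarith
    rw [div_le_div_iff₀ (by positivity) hgam]
    have : 1 ≤ π ^ 2 * π ^ 2 := by nlinarith
    nlinarith [mul_pos hα hgam]
  · rintro lam ⟨hlam, hle⟩
    obtain ⟨-, hle2, hle3⟩ : lam ≤ 1 / 2 ∧ lam ≤ (1 / (1 + q)) ^ 2 ∧
        lam ≤ (gam * π ^ 2) ^ 2 := by simpa only [le_min_iff] using hle
    have hr : 0 < √lam := Real.sqrt_pos.2 hlam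
    have hrr : √lam ^ 2 = lam := Real.sq_sqrt hlam.le
    rw [hFeq lam hlam]
    constructor
    · refine le_trans ?_ (le_integral_greenKuboIntegrand hα hgam hlam)
      have h1 : √lam ≤ gam * π ^ 2 := Real.sqrt_le_iff.2 ⟨by positivity, hle3⟩
      have h2 : 1 / lam ≤ (1 + gam * π ^ 2 / lam) ^ 2 := by
        calc 1 / lam = (√lam / lam) ^ 2 := by
              rw [div_pow, hrr]; field_simp
          _ ≤ (1 + gam * π ^ 2 / lam) ^ 2 := by
              gcongr
              have : √lam / lam ≤ gam * π ^ 2 / lam := by gcongr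
              linarith
      have h3 := Real.log_le_log (by positivity) h2
      rw [Real.log_pow] at h3
      calc α / (16 * gam * π ^ 2) * Real.log (1 / lam)
          ≤ α / (16 * gam * π ^ 2) * (2 * Real.log (1 + gam * π ^ 2 / lam)) := by
            gcongr
            exact_mod_cast h3
        _ = _ := by ring
    · refine (integral_greenKuboIntegrand_le hα hgam hlam).trans ?_
      rw [← hq]
      have h1 : √lam ≤ 1 / (1 + q) := Real.sqrt_le_iff.2 ⟨by positivity, hle2⟩
      rw [le_div_iff₀ (by positivity)] at h1
      have h2 : 1 + q / √lam ≤ 1 / lam := by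
        have e : 1 / lam = 1 / √lam / √lam := by rw [div_div, ← sq, hrr]
        have e2 : 1 + q / √lam = (√lam + q) / √lam := by field_simp
        rw [e, e2]
        gcongr
        rw [le_div_iff₀ hr]
        nlinarith [mul_pos hr hq0]
      gcongr
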